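/- Let 0 ≤ q < 1 and β > 0. For every w ∈ ℂ with |w|² < β/(1-q) and every natural number m, the coherent kernel K_w(z) = ∑_{n=0}^∞ (w̄^n/(β^n·[n]_q!))·z^n satisfies the reproducing property against monomials in L²(ν_q): (q;q)_∞ · ∑_{j=0}^∞ (q^j/(q;q)_j) · (1/(2π)) ∫_0^{2π} \overline{K_w(r_j e^{iθ})} · (r_j e^{iθ})^m dθ = w^m. -/

import Mathlib

/-- The q-integer `[n]_q = 1 + q + ⋯ + q^(n-1)`. -/
noncomputable def qInt (q : ℝ) (n : ℕ) : ℝ := ∑ i ∈ Finset.range n, q ^ i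

/-- The q-factorial `[n]_q! = [1]_q ⋯ [n]_q`. -/
noncomputable def qFact (q : ℝ) (n : ℕ) : ℝ := ∏ i ∈ Finset.range n, qInt q (i + 1)

/-- The q-Pochhammer symbol `(a;q)_n = ∏_{j=0}^{n-1} (1 - a q^j)`. -/
noncomputable def qPoch (a q : ℝ) (n : ℕ) : ℝ := ∏ j ∈ Finset.range n, (1 - a * q ^ j)

/-- The infinite q-Pochhammer symbol `(a;q)_∞ = ∏_{j=0}^{∞} (1 - a q^j)`. -/
noncomputable def qPochInf (a q : ℝ) : ℝ := ∏' j : ℕ, (1 - a * q ^ j)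

/-- The radius `r_j = q^{j/2} √(β/(1-q))`. -/
noncomputable def rRad (q β : ℝ) (j : ℕ) : ℝ := Real.sqrt (q ^ j) * Real.sqrt (β / (1 - q))

/-- The coherent kernel `K_w(z) = ∑_{n=0}^∞ (w̄^n/(β^n [n]_q!)) z^n`. -/
noncomputable def coherentKernel (q β : ℝ) (w : ℂ) : ℂ → ℂ :=
  fun z => ∑' n : ℕ, (starRingEnd ℂ) w ^ n / ((β ^ n * qFact q n : ℝ) : ℂ) * z ^ n

open Filter Topology

theorem one_sub_mul_pow_pos {q : ℝ} (hq0 : 0 ≤ q) (hq1 : q < 1) (j : ℕ) : 0 < 1 - q * q ^ j := by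
  rw [← pow_succ']
  exact sub_pos.2 (pow_lt_one₀ hq0 hq1 j.succ_ne_zero)

theorem qPoch_self_pos {q : ℝ} (hq0 : 0 ≤ q) (hq1 : q < 1) (n : ℕ) : 0 < qPoch q q n :=
  Finset.prod_pos fun j _ => one_sub_mul_pow_pos hq0 hq1 j

theorem qPoch_succ (a q : ℝ) (n : ℕ) : qPoch a q (n + 1) = qPoch a q n * (1 - a * q ^ n) :=
  Finset.prod_range_succ _ _

theorem one_sub_pow_mul_qFact (q : ℝ) (n : ℕ) :
    (1 - q) ^ n * qFact q n = qPoch q q n := by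
  have h1 : ∀ i, (1 - q) * qInt q (i + 1) = 1 - q * q ^ i := fun i => by
    rw [qInt, mul_neg_geom_sum, pow_succ']
  simp [qFact, qPoch, ← h1, Finset.prod_mul_distrib]

theorem tendsto_qPoch_self {q : ℝ} (hq0 : 0 ≤ q) (hq1 : q < 1) :
    Tendsto (qPoch q q) atTop (𝓝 (qPochInf q q)) := by
  have h : Multipliable fun j : ℕ => 1 - q * q ^ j := by
    simp_rw [sub_eq_add_neg]
    refine multipliable_one_add_of_summable ?_
    simpa [abs_of_nonneg hq0] using (summable_geometric_of_lt_one hq0 hq1).mul_left q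
  exact h.hasProd.tendsto_prod_nat

theorem summable_pow_div_qPoch {q x : ℝ} (hq0 : 0 ≤ q) (hq1 : q < 1) (hx0 : 0 ≤ x) (hx1 : x < 1) :
    Summable fun j : ℕ => x ^ j / qPoch q q j := by
  obtain ⟨r, hxr, hr1⟩ := exists_between hx1
  have hlim : Tendsto (fun j : ℕ => x / (1 - q * q ^ j)) atTop (𝓝 x) := by
    have := (tendsto_pow_atTop_nhds_zero_of_lt_one hq0 hq1).const_mul q
    have h : Tendsto (fun j : ℕ => x / (1 - q * q ^ j)) atTop (𝓝 (x / (1 - q * 0))) :=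
      tendsto_const_nhds.div (this.const_sub 1) (by simp)
    simpa using h
  refine summable_of_ratio_norm_eventually_le hr1 ?_
  filter_upwards [hlim.eventually (gt_mem_nhds hxr)] with j hj
  have hp := qPoch_self_pos hq0 hq1 j
  have hp' := qPoch_self_pos hq0 hq1 (j + 1)
  rw [Real.norm_of_nonneg (by positivity), Real.norm_of_nonneg (by positivity), qPoch_succ,
    pow_succ', mul_comm (qPoch q q j), mul_div_mul_comm]
  exact mul_le_mul_of_nonneg_right hj.le (by positivity)

/-- One step of the functional equation `(1 - x) F(x) = F(q x)` of `F(x) = ∑ x^j / (q;q)_j`. -/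
theorem one_sub_mul_tsum_pow_div_qPoch {q x : ℝ} (hq0 : 0 ≤ q) (hq1 : q < 1) (hx0 : 0 ≤ x)
    (hx1 : x < 1) :
    (1 - x) * ∑' j : ℕ, x ^ j / qPoch q q j = ∑' j : ℕ, (x * q) ^ j / qPoch q q j := by
  have hs := summable_pow_div_qPoch hq0 hq1 hx0 hx1
  have hs' := summable_pow_div_qPoch hq0 hq1 (mul_nonneg hx0 hq0)
    (mul_lt_one_of_nonneg_of_lt_one_left hx0 hx1 hq1.le)
  have hdiff : ∑' j : ℕ, (x ^ j / qPoch q q j - (x * q) ^ j / qPoch q q j)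
      = x * ∑' j : ℕ, x ^ j / qPoch q q j := by
    rw [(hs.sub hs').tsum_eq_zero_add, ← tsum_mul_left]
    simp only [pow_zero, sub_self, zero_add]
    refine tsum_congr fun j => ?_
    have hp := (qPoch_self_pos hq0 hq1 j).ne'
    have hp' := (one_sub_mul_pow_pos hq0 hq1 j).ne'
    rw [qPoch_succ]
    field_simp
    ring
  rw [hs.tsum_sub hs'] at hdiff
  linarith

theorem tsum_pow_succ_pow_div_qPoch {q : ℝ} (hq0 : 0 ≤ q) (hq1 : q < 1) (m : ℕ) :
    ∑' j : ℕ, (q ^ (m + 1)) ^ j / qPoch q q j = qPoch q q m * ∑' j : ℕ, q ^ j / qPoch q q j := by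
  induction m with
  | zero => simp [qPoch]
  | succ m ih =>
    rw [qPoch_succ, mul_right_comm, ← ih, pow_succ q (m + 1),
      ← one_sub_mul_tsum_pow_div_qPoch hq0 hq1 (pow_nonneg hq0 _)
        (pow_lt_one₀ hq0 hq1 m.succ_ne_zero), pow_succ' q m]
    ring

theorem qPochInf_mul_tsum_pow_div_qPoch {q : ℝ} (hq0 : 0 ≤ q) (hq1 : q < 1) :
    qPochInf q q * ∑' j : ℕ, q ^ j / qPoch q q j = 1 := by
  have h1 : Tendsto (fun m : ℕ => ∑' j : ℕ, (q ^ (m + 1)) ^ j / qPoch q q j) atTop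
      (𝓝 (∑' j : ℕ, if j = 0 then (1 : ℝ) else 0)) := by
    refine tendsto_tsum_of_dominated_convergence (summable_pow_div_qPoch hq0 hq1 hq0 hq1)
      (fun j => ?_) (Eventually.of_forall fun m j => ?_)
    · rcases eq_or_ne j 0 with rfl | hj
      · simp [qPoch]
      · have := (((tendsto_pow_atTop_nhds_zero_of_lt_one hq0 hq1).comp
          (tendsto_add_atTop_nat 1)).pow j).div_const (qPoch q q j)
        simpa [hj] using this
    · have hp := qPoch_self_pos hq0 hq1 j
      rw [Real.norm_of_nonneg (by positivity)]
      gcongr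
      exact pow_le_of_le_one hq0 hq1.le m.succ_ne_zero
  rw [tsum_ite_eq] at h1
  simp_rw [tsum_pow_succ_pow_div_qPoch hq0 hq1] at h1
  exact tendsto_nhds_unique ((tendsto_qPoch_self hq0 hq1).mul_const _) h1

theorem integral_exp_int_mul_I (k : ℤ) :
    ∫ θ in (0 : ℝ)..(2 * Real.pi), Complex.exp (k * Complex.I * θ)
      = if k = 0 then 2 * (Real.pi : ℂ) else 0 := by
  split_ifs with hk
  · simp [hk]
  · rw [integral_exp_mul_complex (by simpa using hk)]
    have : (k : ℂ) * Complex.I * ((2 * Real.pi : ℝ) : ℂ) = k * (2 * Real.pi * Complex.I) := by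
      push_cast; ring
    rw [this, Complex.exp_int_mul_two_pi_mul_I]
    simp

/-- Pairing a power series with a monomial on a circle of radius `r` picks out one coefficient. -/
theorem integral_conj_tsum_mul_pow {a : ℕ → ℂ} {r : ℝ} (hr : 0 ≤ r)
    (ha : Summable fun n => ‖a n‖ * r ^ n) (m : ℕ) :
    ∫ θ in (0 : ℝ)..(2 * Real.pi),
        (starRingEnd ℂ) (∑' n : ℕ, a n * ((r : ℂ) * Complex.exp (θ * Complex.I)) ^ n) *
          ((r : ℂ) * Complex.exp (θ * Complex.I)) ^ m
      = 2 * Real.pi * ((starRingEnd ℂ) (a m) * ((r ^ 2) ^ m : ℝ)) := by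
  have hterm : ∀ (n : ℕ) (θ : ℝ),
      (starRingEnd ℂ) (a n * ((r : ℂ) * Complex.exp (θ * Complex.I)) ^ n) *
          ((r : ℂ) * Complex.exp (θ * Complex.I)) ^ m
        = (starRingEnd ℂ) (a n) * (r : ℂ) ^ (n + m) *
          Complex.exp (((m - n : ℤ) : ℂ) * Complex.I * θ) := by
    intro n θ
    have he : Complex.exp (((m - n : ℤ) : ℂ) * Complex.I * θ)
        = Complex.exp (-(θ * Complex.I)) ^ n * Complex.exp (θ * Complex.I) ^ m := by
      rw [← Complex.exp_nat_mul, ← Complex.exp_nat_mul, ← Complex.exp_add]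
      congr 1
      push_cast
      ring
    rw [he]
    simp only [map_mul, map_pow, Complex.conj_ofReal, ← Complex.exp_conj, Complex.conj_I,
      mul_neg]
    ring
  have hnorm : ∀ (n : ℕ) (θ : ℝ), ‖a n * ((r : ℂ) * Complex.exp (θ * Complex.I)) ^ n‖
      = ‖a n‖ * r ^ n := by
    intro n θ
    simp [Complex.norm_exp_ofReal_mul_I, abs_of_nonneg hr]
  have hnorm' : ∀ θ : ℝ, ‖((r : ℂ) * Complex.exp (θ * Complex.I)) ^ m‖ = r ^ m := by
    intro θ
    simp [Complex.norm_exp_ofReal_mul_I, abs_of_nonneg hr]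
  have hsum := intervalIntegral.hasSum_integral_of_dominated_convergence
    (μ := MeasureTheory.volume) (a := 0) (b := 2 * Real.pi)
    (F := fun (n : ℕ) (θ : ℝ) =>
      (starRingEnd ℂ) (a n * ((r : ℂ) * Complex.exp (θ * Complex.I)) ^ n) *
          ((r : ℂ) * Complex.exp (θ * Complex.I)) ^ m)
    (f := fun θ : ℝ =>
      (starRingEnd ℂ) (∑' n : ℕ, a n * ((r : ℂ) * Complex.exp (θ * Complex.I)) ^ n) *
          ((r : ℂ) * Complex.exp (θ * Complex.I)) ^ m)
    (fun n _ => ‖a n‖ * r ^ n * r ^ m)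
    (fun n => by
      simp_rw [hterm]
      exact (by fun_prop : Continuous _).aestronglyMeasurable)
    (fun n => .of_forall fun θ _ => by
      rw [norm_mul, RCLike.norm_conj, hnorm, hnorm'])
    (.of_forall fun _ _ => ha.mul_right _)
    intervalIntegrable_const
    (.of_forall fun θ _ => by
      refine HasSum.mul_right _ ?_
      have hs : Summable fun n => a n * ((r : ℂ) * Complex.exp (θ * Complex.I)) ^ n :=
        .of_norm (by simpa only [hnorm] using ha)
      exact hs.hasSum.map (starRingEnd ℂ) Complex.continuous_conj)
  rw [← hsum.tsum_eq, tsum_eq_single m]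
  · simp_rw [hterm, intervalIntegral.integral_const_mul, integral_exp_int_mul_I]
    simp only [sub_self, if_true]
    push_cast
    ring
  · intro n hn
    simp_rw [hterm, intervalIntegral.integral_const_mul, integral_exp_int_mul_I]
    rw [if_neg (by omega), mul_zero]

/-- The reproducing property of the coherent kernel against monomials in
`L²(ν_q)`: `⟨K_w, z^m⟩ = w^m`. -/
theorem coherentKernel_reproducing (q β : ℝ) (hq0 : 0 ≤ q) (hq1 : q < 1)
    (hβ : 0 < β) (w : ℂ) (hw : ‖w‖ ^ 2 < β / (1 - q)) (m : ℕ) :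
    (qPochInf q q : ℂ) *
      ∑' j : ℕ, (((q ^ j / qPoch q q j : ℝ) : ℂ) *
        (((1 : ℝ) / (2 * Real.pi) : ℝ) : ℂ) *
        ∫ θ in (0 : ℝ)..(2 * Real.pi),
          (starRingEnd ℂ)
              (coherentKernel q β w (((rRad q β j : ℝ) : ℂ) * Complex.exp (θ * Complex.I))) *
            (((rRad q β j : ℝ) : ℂ) * Complex.exp (θ * Complex.I)) ^ m)
      = w ^ m := by
  have hq : 0 < 1 - q := sub_pos.2 hq1
  set R : ℝ := β / (1 - q) with hR
  have hR0 : 0 < R := div_pos hβ hq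
  have hden : ∀ n, β ^ n * qFact q n = R ^ n * qPoch q q n := fun n => by
    rw [← one_sub_pow_mul_qFact, hR, div_pow]
    field_simp
  have hr0 : ∀ j, 0 ≤ rRad q β j := fun j => mul_nonneg (Real.sqrt_nonneg _) (Real.sqrt_nonneg _)
  have hr2 : ∀ j, rRad q β j ^ 2 = q ^ j * R := fun j => by
    rw [rRad, mul_pow, Real.sq_sqrt (pow_nonneg hq0 j), Real.sq_sqrt hR0.le]
  have hwr : ∀ j, ‖w‖ * rRad q β j / R < 1 := fun j => by
    rw [div_lt_one hR0]
    refine lt_of_pow_lt_pow_left₀ 2 hR0.le ?_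
    rw [mul_pow, hr2, sq R]
    refine mul_lt_mul_of_lt_of_le_of_nonneg_of_pos hw ?_ (sq_nonneg _) hR0
    exact mul_le_of_le_one_left hR0.le (pow_le_one₀ hq0 hq1.le)
  have hsum : ∀ j, Summable fun n : ℕ =>
      ‖(starRingEnd ℂ) w ^ n / ((β ^ n * qFact q n : ℝ) : ℂ)‖ * rRad q β j ^ n := fun j => by
    refine (summable_pow_div_qPoch hq0 hq1 (by have := hr0 j; positivity) (hwr j)).congr
      fun n => ?_
    have hp := qPoch_self_pos hq0 hq1 n
    rw [hden, norm_div, norm_pow, RCLike.norm_conj, Complex.norm_real,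
      Real.norm_of_nonneg (by positivity), div_pow, mul_pow]
    field_simp
  have hpm := (qPoch_self_pos hq0 hq1 m).ne'
  have hterm : ∀ j : ℕ, ((q ^ j / qPoch q q j : ℝ) : ℂ) *
        (((1 : ℝ) / (2 * Real.pi) : ℝ) : ℂ) *
        ∫ θ in (0 : ℝ)..(2 * Real.pi),
          (starRingEnd ℂ)
              (coherentKernel q β w (((rRad q β j : ℝ) : ℂ) * Complex.exp (θ * Complex.I))) *
            (((rRad q β j : ℝ) : ℂ) * Complex.exp (θ * Complex.I)) ^ m
      = w ^ m / (qPoch q q m : ℂ) * (((q ^ (m + 1)) ^ j / qPoch q q j : ℝ) : ℂ) := fun j => by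
    unfold coherentKernel
    rw [integral_conj_tsum_mul_pow (hr0 j) (hsum j) m, hr2, hden]
    have hR' : (R : ℂ) ≠ 0 := Complex.ofReal_ne_zero.2 hR0.ne'
    have hm' : (qPoch q q m : ℂ) ≠ 0 := Complex.ofReal_ne_zero.2 hpm
    have hj' : (qPoch q q j : ℂ) ≠ 0 :=
      Complex.ofReal_ne_zero.2 (qPoch_self_pos hq0 hq1 j).ne'
    have hpi : (Real.pi : ℂ) ≠ 0 := Complex.ofReal_ne_zero.2 Real.pi_ne_zero
    simp only [map_div₀, map_pow, Complex.conj_conj, Complex.conj_ofReal]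
    push_cast
    field_simp
    ring
  simp_rw [hterm]
  rw [tsum_mul_left, ← Complex.ofReal_tsum, tsum_pow_succ_pow_div_qPoch hq0 hq1]
  have hone : (qPochInf q q : ℂ) * ((∑' j : ℕ, q ^ j / qPoch q q j : ℝ) : ℂ) = 1 := by
    exact_mod_cast qPochInf_mul_tsum_pow_div_qPoch hq0 hq1
  have hm' : (qPoch q q m : ℂ) ≠ 0 := Complex.ofReal_ne_zero.2 hpm
  rw [Complex.ofReal_mul, ← mul_assoc (w ^ m / _), div_mul_cancel₀ _ hm', mul_left_comm, hone,
    mul_one]
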